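/- Let H = {h_i} be a twice differentiable O-sequence with h_0 = 1 and h_1 = 4, whose first difference ΔH is eventually constant with value d; let t be the least index with (ΔH)_t = d and set s = ⌊(d−1)/2⌋. Assume d > 3 and t ≤ s − 1. Define e_i = (ΔH)_{i+2} − min(2(i+2)+1, 2s) for i ≥ 0. Then every e_i is a positive integer, e_0 = 1, the sequence {e_i} is an O-sequence, and e_i = d − 2s for all i ≥ s − 2. -/

import Mathlib

/-!
STATEMENT 5 (Claim 2 of the Basic Construction): with `H, b = ΔH, c = Δ²H, d,
t, s` as in Statement 2, the sequence `e_i = (ΔH)_{i+2} − min(2(i+2)+1, 2s)`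
consists of positive integers, starts with `e_0 = 1`, is an O-sequence, and
equals `d − 2s` in all degrees `i ≥ s − 2`.
-/

/-- Greedy top term `m_i` of the `i`-binomial expansion of `a`. -/
def binomExpTop (a i : ℕ) : ℕ :=
  Nat.findGreatest (fun m => Nat.choose m i ≤ a) (a + i)

/-- Macaulay growth function: `macaulayGrow i a = a^⟨i⟩`, with `0^⟨i⟩ = 0`. -/
def macaulayGrow : ℕ → ℕ → ℕ
  | 0, _ => 0
  | (i + 1), a =>
    if a = 0 then 0
    else Nat.choose (binomExpTop a (i + 1) + 1) (i + 2)
      + macaulayGrow i (a - Nat.choose (binomExpTop a (i + 1)) (i + 1))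

/-- O-sequence: `a_0 = 1` and `a_{i+1} ≤ a_i^⟨i⟩` for all `i ≥ 1`. -/
def IsOSequence (a : ℕ → ℕ) : Prop :=
  a 0 = 1 ∧ ∀ i : ℕ, 1 ≤ i → a (i + 1) ≤ macaulayGrow i (a i)


lemma top_le (a i : ℕ) (hi : 1 ≤ i) : Nat.choose (binomExpTop a i) i ≤ a := by
  unfold binomExpTop
  have h0 : Nat.choose 0 i ≤ a := by
    rw [Nat.choose_eq_zero_of_lt (by omega)]; omega
  exact Nat.findGreatest_spec (P := fun m => Nat.choose m i ≤ a) (Nat.zero_le _) h0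

lemma choose_big (a i : ℕ) : a + 1 ≤ Nat.choose (a + (i + 1)) (i + 1) := by
  induction a with
  | zero => simp
  | succ a ih =>
    have h : a + 1 + (i + 1) = (a + (i + 1)) + 1 := by ring
    rw [h, Nat.choose_succ_succ']
    have : 0 < Nat.choose (a + (i + 1)) i := Nat.choose_pos (by omega)
    omega

lemma lt_top (a i m : ℕ) (hi : 1 ≤ i) (hm : Nat.choose m i ≤ a) : m ≤ binomExpTop a i := by
  unfold binomExpTop
  refine Nat.le_findGreatest (P := fun m => Nat.choose m i ≤ a) ?_ hm
  by_contra hlt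
  obtain ⟨i, rfl⟩ : ∃ k, i = k + 1 := ⟨i - 1, by omega⟩
  have h1 := choose_big a i
  have h2 := Nat.choose_le_choose (i + 1) (show a + (i + 1) ≤ m by omega)
  omega

lemma top_lt (a i m : ℕ) (hi : 1 ≤ i) (hm : a < Nat.choose m i) : binomExpTop a i < m := by
  by_contra h
  have h1 := top_le a i hi
  have h2 := Nat.choose_le_choose i (show m ≤ binomExpTop a i by omega)
  omega

lemma grow_zero (i : ℕ) : macaulayGrow i 0 = 0 := by
  cases i <;> simp [macaulayGrow]

lemma grow_small (i : ℕ) : ∀ a, a ≤ i → macaulayGrow i a ≤ a := by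
  induction i with
  | zero => intro a ha; simp [macaulayGrow]
  | succ i ih =>
    intro a ha
    rw [macaulayGrow]
    split_ifs with h
    · omega
    have h1 : i + 1 ≤ binomExpTop a (i + 1) := lt_top _ _ _ (by omega) (by simp; omega)
    have h2 : binomExpTop a (i + 1) < i + 2 := top_lt _ _ _ (by omega) (by
      rw [Nat.choose_succ_self_right]; omega)
    have h3 : binomExpTop a (i + 1) = i + 1 := by omega
    rw [h3]
    simp only [Nat.choose_self]
    have := ih (a - 1) (by omega)
    omega

lemma grow_succ (i : ℕ) (hi : 1 ≤ i) : macaulayGrow i (i + 1) ≤ i + 2 := by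
  obtain ⟨i, rfl⟩ : ∃ k, i = k + 1 := ⟨i - 1, by omega⟩
  rw [macaulayGrow, if_neg (by omega)]
  have h1 : i + 2 ≤ binomExpTop (i + 1 + 1) (i + 1) := lt_top _ _ _ (by omega) (by
    rw [Nat.choose_succ_self_right])
  have h2 : binomExpTop (i + 1 + 1) (i + 1) < i + 3 := top_lt _ _ _ (by omega) (by
    have h4 : (i + 2).choose (i + 1) = i + 2 := Nat.choose_succ_self_right _
    have h5 : (i + 3).choose (i + 1) = (i + 2).choose i + (i + 2).choose (i + 1) :=
      Nat.choose_succ_succ' _ _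
    have : 0 < (i + 2).choose i := Nat.choose_pos (by omega)
    omega)
  have h3 : binomExpTop (i + 1 + 1) (i + 1) = i + 2 := by omega
  rw [h3]
  have h4 : (i + 2).choose (i + 1) = i + 2 := Nat.choose_succ_self_right _
  have h5 : (i + 2 + 1).choose (i + 2) = i + 3 := Nat.choose_succ_self_right _
  rw [h4, h5]
  simp [grow_zero]

/-- Size of the union of the first `g` lines in degree `i`. -/
def lineSum (i g : ℕ) : ℕ := ∑ l ∈ Finset.range g, (i + 1 - l)

lemma lineSum_succ_left (i g : ℕ) : lineSum (i + 1) (g + 1) = (i + 2) + lineSum i g := by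
  unfold lineSum
  rw [Finset.sum_range_succ', add_comm]
  congr 1
  apply Finset.sum_congr rfl
  intro l _
  omega

lemma lineSum_step (i g : ℕ) : lineSum (i + 1) g = lineSum i g + min (i + 2) g := by
  unfold lineSum
  induction g with
  | zero => simp
  | succ g ih =>
    rw [Finset.sum_range_succ, Finset.sum_range_succ, ih]
    omega

lemma lineSum_zero_left (g : ℕ) : lineSum 0 g ≤ 1 := by
  unfold lineSum
  cases g with
  | zero => simp
  | succ g => rw [Finset.sum_range_succ']; simp

lemma lineSum_zero_right (i : ℕ) : lineSum i 0 = 0 := by simp [lineSum]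

lemma grow_lower (i : ℕ) : ∀ a g, g ≤ i + 2 → lineSum i g ≤ a → (i = 0 → a = 0 ∧ g = 0) →
    a + g ≤ macaulayGrow i a := by
  induction i with
  | zero =>
    intro a g _ _ h
    obtain ⟨rfl, rfl⟩ := h rfl
    simp
  | succ i ih =>
    intro a g hg hS _
    rw [macaulayGrow]
    have hg0 : g ≠ 0 → i + 2 ≤ a := by
      intro h
      obtain ⟨g, rfl⟩ := Nat.exists_eq_succ_of_ne_zero h
      have := lineSum_succ_left i g
      simp only [Nat.succ_eq_add_one] at hS
      omega
    split_ifs with h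
    · by_contra
      omega
    have hle := top_le a (i + 1) (by omega)
    have h1 : i + 1 ≤ binomExpTop a (i + 1) := lt_top _ _ _ (by omega) (by simp; omega)
    have hres : i = 0 → a - Nat.choose (binomExpTop a (i + 1)) (i + 1) = 0 := by
      rintro rfl
      have := lt_top a 1 a le_rfl (by simp)
      simp only [zero_add, Nat.choose_one_right]
      omega
    have ih0 := ih (a - Nat.choose (binomExpTop a (i + 1)) (i + 1)) 0 (by omega)
      (by simp [lineSum_zero_right]) (fun h => ⟨hres h, rfl⟩)
    rcases Nat.lt_or_ge (binomExpTop a (i + 1)) (i + 3) with hlt | hge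
    · rcases Nat.lt_or_ge (binomExpTop a (i + 1)) (i + 2) with hlt2 | hge2
      · have h3 : binomExpTop a (i + 1) = i + 1 := by omega
        have : g = 0 := by
          by_contra hne
          have := lt_top a (i + 1) (i + 2) (by omega) (by
            rw [Nat.choose_succ_self_right]; exact hg0 hne)
          omega
        rw [h3] at ih0 hle ⊢
        simp only [Nat.choose_self] at *
        omega
      · have h3 : binomExpTop a (i + 1) = i + 2 := by omega
        have h4 : (i + 2).choose (i + 1) = i + 2 := Nat.choose_succ_self_right _
        have h5 : (i + 2 + 1).choose (i + 2) = i + 3 := Nat.choose_succ_self_right _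
        rw [h3, h4] at ih0 hle hres
        rw [h3, h4, h5]
        rcases Nat.eq_zero_or_pos g with hz | hpos
        · omega
        · obtain ⟨g, rfl⟩ : ∃ k, g = k + 1 := ⟨g - 1, by omega⟩
          rw [lineSum_succ_left] at hS
          have := ih (a - (i + 2)) g (by omega) (by omega) (fun h0 => ⟨hres h0, by
            have := hres h0
            subst h0
            by_contra hne
            obtain ⟨k, rfl⟩ := Nat.exists_eq_succ_of_ne_zero hne
            have : 1 ≤ lineSum 0 (k + 1) := by
              unfold lineSum
              rw [Finset.sum_range_succ']
              simp
            simp only [Nat.succ_eq_add_one] at hS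
            omega⟩)
          omega
    · have h6 := Nat.choose_succ_succ (binomExpTop a (i + 1)) (i + 1)
      have h7 := Nat.choose_le_choose (i + 2) hge
      have h8 : (i + 3).choose (i + 2) = i + 3 := Nat.choose_succ_self_right _
      simp only [Nat.succ_eq_add_one] at h6
      have h9 : i + 1 + 1 = i + 2 := rfl
      rw [h9] at h6
      omega

lemma le_grow (i a : ℕ) (hi : 1 ≤ i) : a ≤ macaulayGrow i a := by
  have := grow_lower i a 0 (by omega) (by simp [lineSum_zero_right]) (by omega)
  simpa using this

theorem difference_with_complete_intersection_is_o_sequence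
    (H b c : ℕ → ℕ) (d t s : ℕ)
    (hH0 : H 0 = 1) (hH1 : H 1 = 4)
    (hb0 : b 0 = H 0) (hb : ∀ i : ℕ, H (i + 1) = H i + b (i + 1))
    (hc0 : c 0 = b 0) (hc : ∀ i : ℕ, b (i + 1) = b i + c (i + 1))
    (hOH : IsOSequence H) (hOb : IsOSequence b) (hOc : IsOSequence c)
    (hev : ∃ N : ℕ, ∀ i : ℕ, N ≤ i → b i = d)
    (htd : b t = d) (htmin : ∀ i : ℕ, i < t → b i ≠ d)
    (hs : s = (d - 1) / 2)
    (hd : 3 < d) (hts : t ≤ s - 1)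
    (e : ℕ → ℕ) (he : ∀ i : ℕ, e i = b (i + 2) - min (2 * (i + 2) + 1) (2 * s)) :
    (∀ i : ℕ, min (2 * (i + 2) + 1) (2 * s) < b (i + 2)) ∧
    e 0 = 1 ∧
    IsOSequence e ∧
    (∀ i : ℕ, s - 2 ≤ i → e i = d - 2 * s) := by
  have hb00 : b 0 = 1 := by omega
  have hc00 : c 0 = 1 := by omega
  have hb1 : b 1 = 3 := by have := hb 0; simp only [zero_add] at this; omega
  have hc1 : c 1 = 2 := by have := hc 0; simp only [zero_add] at this; omega
  have hcle : ∀ i, c i ≤ i + 1 := by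
    intro i
    induction i with
    | zero => omega
    | succ i ih =>
      rcases Nat.eq_zero_or_pos i with rfl | hi
      · simp only [zero_add]; omega
      have h := hOc.2 i hi
      rcases Nat.lt_or_ge i (c i) with h1 | h1
      · have h2 : c i = i + 1 := by omega
        rw [h2] at h
        have := grow_succ i hi
        omega
      · have := grow_small i (c i) h1
        omega
  have hcstep : ∀ k, min (k + 1) (c (k + 1)) ≤ c k := by
    intro k
    rcases Nat.eq_zero_or_pos k with rfl | hi
    · omega
    have h := hOc.2 k hi
    rcases Nat.lt_or_ge k (c k) with h1 | h1
    · omega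
    · have := grow_small k (c k) h1
      omega
  have hcP : ∀ n k, min (k + 1) (c (k + n)) ≤ c k := by
    intro n
    induction n with
    | zero => intro k; simp
    | succ n ih =>
      intro k
      have h1 := ih (k + 1)
      have h2 := hcstep k
      have h3 : k + 1 + n = k + (n + 1) := by ring
      rw [h3] at h1
      omega
  have hcP' : ∀ k j, k ≤ j → min (k + 1) (c j) ≤ c k := by
    intro k j hkj
    obtain ⟨n, rfl⟩ := Nat.exists_eq_add_of_le hkj
    exact hcP n k
  have hmono : Monotone b := monotone_nat_of_le_succ (fun n => by have := hc n; omega)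
  have hbd : ∀ i, t ≤ i → b i = d := by
    intro i hi
    obtain ⟨N, hN⟩ := hev
    have h1 := hmono hi
    have h2 := hmono (le_max_left i N)
    have h3 := hN (max i N) (le_max_right _ _)
    omega
  have ht2 : 2 ≤ t := by
    by_contra hlt
    have : t = 0 ∨ t = 1 := by omega
    rcases this with rfl | rfl <;> omega
  have hc2 : c 2 = 3 := by
    by_contra hne
    have hle2 : c 2 ≤ 2 := by have := hcle 2; omega
    have hb' : ∀ n, b n ≤ 2 * n + 1 := by
      intro n
      induction n with
      | zero => omega
      | succ n ih =>
        have h1 := hc n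
        have h2 : c (n + 1) ≤ 2 := by
          rcases Nat.lt_or_ge (n + 1) 2 with h | h
          · have : n = 0 := by omega
            subst this
            simp only [zero_add]; omega
          · have := hcP' 2 (n + 1) h
            omega
        omega
    have := hb' t
    omega
  have hb2 : b 2 = 6 := by have := hc 1; simp only [Nat.reduceAdd] at this; omega
  have hlow : ∀ g n, (∀ k, k ≤ n → min (k + 3) (g + 2) ≤ c (k + 2)) →
      2 * n + 5 + lineSum n g ≤ b (n + 2) := by
    intro g n
    induction n with
    | zero =>
      intro _
      have := lineSum_zero_left g
      simp only [zero_add]; omega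
    | succ n ih =>
      intro h
      have h1 := ih (fun k hk => h k (by omega))
      have h2 := h (n + 1) le_rfl
      have h3 := hc (n + 2)
      have h4 : n + 1 + 2 = n + 2 + 1 := by ring
      rw [h4] at h2 ⊢
      rw [lineSum_step]
      omega
  have hslow : ∀ j n, c j ≤ 1 → 2 ≤ j → b (j + n) ≤ b j + n := by
    intro j n hj hj2
    induction n with
    | zero => simp
    | succ n ih =>
      have h1 := hc (j + n)
      have h2 := hcP' j (j + n + 1) (by omega)
      rw [← add_assoc]
      omega
  have hpos6 : ∀ n, 2 ≤ c (n + 2) → 2 * n + 6 ≤ b (n + 2) := by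
    intro n
    induction n with
    | zero => intro _; simp only [zero_add]; omega
    | succ n ih =>
      intro h
      have h1 := hcP' (n + 2) (n + 1 + 2) (by omega)
      have h2 := ih (by omega)
      have h3 := hc (n + 2)
      have h4 : n + 1 + 2 = n + 2 + 1 := by ring
      rw [h4] at h ⊢
      omega
  have hpos : ∀ i : ℕ, min (2 * (i + 2) + 1) (2 * s) < b (i + 2) := by
    intro i
    rcases Nat.lt_or_ge (i + 2) s with h | h
    · rcases Nat.lt_or_ge (c (i + 2)) 2 with h1 | h1
      · have h2 := hslow (i + 2) (s - 1 - (i + 2)) (by omega) (by omega)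
        have h3 : i + 2 + (s - 1 - (i + 2)) = s - 1 := by omega
        rw [h3, hbd _ hts] at h2
        omega
      · have := hpos6 i h1
        omega
    · have := hbd (i + 2) (by omega)
      omega
  have he0 : e 0 = 1 := by
    rw [he 0]
    simp only [zero_add]
    omega
  refine ⟨hpos, he0, ⟨he0, ?_⟩, ?_⟩
  · intro i hi
    have hei := he i
    have hei1 := he (i + 1)
    have h4 : i + 1 + 2 = i + 2 + 1 := by ring
    have hp := hpos i
    have hp1 := hpos (i + 1)
    have hci := hc (i + 2)
    have hlg := le_grow i (e i) hi
    rw [h4] at hei1 hp1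
    rcases Nat.lt_or_ge (i + 3) s with h | h
    · rcases Nat.lt_or_ge 2 (c (i + 2 + 1)) with h1 | h1
      · have hg := hcle (i + 2 + 1)
        have hl := hlow (c (i + 2 + 1) - 2) i (by
          intro k hk
          have := hcP' (k + 2) (i + 2 + 1) (by omega)
          omega)
        have := grow_lower i (e i) (c (i + 2 + 1) - 2) (by omega) (by omega) (by omega)
        omega
      · omega
    · have h5 := hbd (i + 2 + 1) (by omega)
      have h6 := hbd (i + 2) (by omega)
      omega
  · intro i hi
    have := he i
    have := hbd (i + 2) (by omega)
    omega
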